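/- arXiv:quant-ph/0609138 — 5 statements merged into one kernel-verified Lean document; each statement's English description precedes it below -/
import Mathlib

section
/- There is a constant C > 0 such that for all n ≥ 1 and all real z with 0 < z < 1/n, ∑_{π ∈ S_n} z^{t(π)} ≤ C·√n · e^{−n} · (1 − z·n)^{−1/z}. -/
noncomputable section

/-- `t(π) = s(π) − c(π)`: the minimal number of transpositions whose product is `π`,
where `s(π)` is the number of points moved by `π` and `c(π)` is the number of
nontrivial cycles of `π`. -/
def tPerm {n : ℕ} (π : Equiv.Perm (Fin n)) : ℕ :=
  π.support.card - π.cycleType.card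

open Equiv Equiv.Perm in
/-- Splitting off a point `x` moved by `f` lowers the support size minus the number of nontrivial
cycles by one. -/
theorem card_support_add_card_cycleType_swap_mul {α : Type*} [Fintype α] [DecidableEq α]
    (f : Perm α) {x : α} (hx : f x ≠ x) :
    f.support.card + (swap x (f x) * f).cycleType.card =
      (swap x (f x) * f).support.card + f.cycleType.card + 1 := by
  set c := f.cycleOf x
  set r := f * c⁻¹ with hr
  have hcf : c ∈ f.cycleFactorsFinset := cycleOf_mem_cycleFactorsFinset_iff.2 (mem_support.2 hx)
  have hdisj : c.Disjoint r := (disjoint_mul_inv_of_mem_cycleFactorsFinset hcf).symm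
  have hf : f = c * r := by
    rw [hdisj.commute.eq, hr, inv_mul_cancel_right]
  have hcyc : c.IsCycle := isCycle_cycleOf f hx
  have hcx : c x = f x := cycleOf_apply_self f x
  have hcx' : c x ≠ x := hcx ▸ hx
  have hs : f.support.card = c.support.card + r.support.card := by
    rw [← hdisj.card_support_mul, ← hf]
  have ht : f.cycleType.card = 1 + r.cycleType.card := by
    conv_lhs => rw [hf]
    rw [hdisj.cycleType_mul, hcyc.cycleType, Multiset.card_add, Multiset.card_singleton]
  have hg : swap x (f x) * f = swap x (c x) * c * r := by
    rw [hcx, mul_assoc, ← hf]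
  rw [hg, hs, ht]
  by_cases h : c (c x) = x
  · have hswap := hcyc.eq_swap_of_apply_apply_eq_self hcx' h
    have hcard : c.support.card = 2 := by
      rw [hswap]; exact card_support_swap hcx'.symm
    have hone : swap x (c x) * c = 1 := by
      conv_lhs => rw [← hswap]
      rw [hswap, swap_mul_self]
    rw [hone, one_mul, hcard]
    omega
  · have hsup : (swap x (c x) * c).support = c.support \ {x} := support_swap_mul_eq c x h
    have hdisj' : (swap x (c x) * c).Disjoint r := by
      rw [disjoint_iff_disjoint_support] at hdisj ⊢
      exact hdisj.mono_left (hsup ▸ Finset.sdiff_subset)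
    have hcard : (swap x (c x) * c).support.card + 1 = c.support.card := by
      rw [hsup, Finset.sdiff_singleton_eq_erase]
      exact Finset.card_erase_add_one (mem_support.2 hcx')
    rw [hdisj'.card_support_mul, hdisj'.cycleType_mul, (hcyc.swap_mul hcx' h).cycleType,
      Multiset.card_add, Multiset.card_singleton]
    omega

theorem Equiv.Perm.card_cycleType_le_card_support {α : Type*} [Fintype α] [DecidableEq α]
    (f : Equiv.Perm α) : f.cycleType.card ≤ f.support.card := by
  rw [← f.sum_cycleType]
  simpa using Multiset.card_nsmul_le_sum (s := f.cycleType) (a := 1)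
    fun k hk => one_le_two.trans (Equiv.Perm.two_le_of_mem_cycleType hk)

theorem tPerm_swap_mul_add_one {n : ℕ} (f : Equiv.Perm (Fin n)) {x : Fin n} (hx : f x ≠ x) :
    tPerm (Equiv.swap x (f x) * f) + 1 = tPerm f := by
  have h := card_support_add_card_cycleType_swap_mul f hx
  have h₁ := (Equiv.swap x (f x) * f).card_cycleType_le_card_support
  unfold tPerm
  omega

theorem tPerm_decomposeFin_symm_zero {n : ℕ} (e : Equiv.Perm (Fin n)) :
    tPerm (Equiv.Perm.decomposeFin.symm (0, e)) = tPerm e := by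
  have h : Equiv.Perm.decomposeFin.symm (0, e) = e.extendDomain (finSuccAboveEquiv 0) := by
    ext i
    cases i using Fin.cases with
    | zero => simp [Equiv.Perm.extendDomain_apply_not_subtype]
    | succ i =>
      have := e.extendDomain_apply_image (finSuccAboveEquiv 0) i
      simp only [finSuccAboveEquiv_apply, Fin.zero_succAbove] at this
      simp [this]
  rw [tPerm, tPerm, h, Equiv.Perm.cycleType_extendDomain, Equiv.Perm.card_support_extend_domain]

theorem tPerm_decomposeFin_symm_succ {n : ℕ} (p : Fin n) (e : Equiv.Perm (Fin n)) :
    tPerm (Equiv.Perm.decomposeFin.symm (p.succ, e)) = tPerm e + 1 := by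
  have h0 : Equiv.Perm.decomposeFin.symm (p.succ, e) 0 = p.succ := by simp
  have h : Equiv.swap 0 p.succ * Equiv.Perm.decomposeFin.symm (p.succ, e) =
      Equiv.Perm.decomposeFin.symm (0, e) := by
    ext i
    cases i using Fin.cases <;> simp
  rw [← tPerm_swap_mul_add_one _ (x := 0) (by rw [h0]; exact p.succ_ne_zero), h0, h,
    tPerm_decomposeFin_symm_zero]

theorem sum_pow_tPerm {R : Type*} [CommSemiring R] (n : ℕ) (z : R) :
    ∑ π : Equiv.Perm (Fin n), z ^ tPerm π = ∏ k ∈ Finset.range n, (1 + k * z) := by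
  induction n with
  | zero => simp [tPerm]
  | succ n ih =>
    rw [← Equiv.Perm.decomposeFin.symm.sum_comp, Fintype.sum_prod_type, Fin.sum_univ_succ,
      Finset.prod_range_succ, ← ih]
    simp only [tPerm_decomposeFin_symm_zero, tPerm_decomposeFin_symm_succ, pow_succ,
      ← Finset.sum_mul, Finset.sum_const, Finset.card_univ, Fintype.card_fin, nsmul_eq_mul]
    ring

theorem prod_one_add_mul_le_exp (n : ℕ) {z : ℝ} (hz : 0 ≤ z) :
    ∏ k ∈ Finset.range n, (1 + k * z) ≤ Real.exp (n ^ 2 * z / 2) := by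
  induction n with
  | zero => simp
  | succ n ih =>
    rw [Finset.prod_range_succ]
    have h : 1 + n * z ≤ Real.exp (n * z) := by
      simpa [add_comm] using Real.add_one_le_exp (n * z)
    calc _ ≤ Real.exp (n ^ 2 * z / 2) * Real.exp (n * z) := by gcongr
      _ ≤ _ := by
        rw [← Real.exp_add]
        gcongr
        push_cast
        nlinarith

theorem add_sq_div_two_le_neg_log_one_sub {x : ℝ} (h0 : 0 ≤ x) (h1 : x < 1) :
    x + x ^ 2 / 2 ≤ -Real.log (1 - x) := by
  have h := Real.hasSum_pow_div_log_of_abs_lt_one (abs_lt.2 ⟨by linarith, h1⟩)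
  have := sum_le_hasSum (Finset.range 2) (fun i _ => by positivity) h
  norm_num [Finset.sum_range_succ] at this
  exact this

/-- There is a constant `C > 0` such that for all `n ≥ 1` and all real `0 < z < 1/n`,
`∑_{π ∈ S_n} z^{t(π)} ≤ C·√n · e^{−n} · (1 − z·n)^{−1/z}`. -/
theorem sum_z_pow_t_le :
    ∃ C : ℝ, 0 < C ∧ ∀ n : ℕ, 1 ≤ n → ∀ z : ℝ, 0 < z → z < 1 / n →
      ∑ π : Equiv.Perm (Fin n), z ^ tPerm π ≤
        C * Real.sqrt n * Real.exp (-(n : ℝ)) * (1 - z * n) ^ (-(1 / z)) := by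
  refine ⟨1, one_pos, fun n hn z hz hzn => ?_⟩
  have hn' : (1 : ℝ) ≤ n := by exact_mod_cast hn
  have hx : z * n < 1 := (lt_div_iff₀ (by positivity)).1 hzn
  have hlog := add_sq_div_two_le_neg_log_one_sub (by positivity) hx
  have hexp : (n : ℝ) ^ 2 * z / 2 ≤ -n + Real.log (1 - z * n) * -(1 / z) := by
    have h := div_le_div_of_nonneg_right hlog hz.le
    have e : (z * n + (z * n) ^ 2 / 2) / z = n + n ^ 2 * z / 2 := by
      field_simp
    rw [e, neg_div] at h
    rw [mul_neg, mul_one_div]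
    linarith
  rw [sum_pow_tPerm, one_mul, mul_assoc, Real.rpow_def_of_pos (by linarith), ← Real.exp_add]
  calc _ ≤ Real.exp (n ^ 2 * z / 2) := prod_one_add_mul_le_exp n hz.le
    _ ≤ Real.exp (-n + Real.log (1 - z * n) * -(1 / z)) := Real.exp_le_exp.2 hexp
    _ ≤ _ := le_mul_of_one_le_left (Real.exp_pos _).le (Real.one_le_sqrt.2 hn')
end
end

section
/- For every constant C > 0 there is a constant B > 0 such that for all integers n > C, ∑_{π ∈ S_n} (C/n²)^{t(π)} ≤ B·√n. -/
noncomputable section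

/-- The difference between the size of the support and the number of nontrivial cycles. -/
def cycleDefect {α : Type*} [Fintype α] [DecidableEq α] (σ : Equiv.Perm α) : ℕ :=
  σ.support.card - σ.cycleType.card

section CycleDefect

open Equiv Equiv.Perm

variable {α β : Type*} [Fintype α] [DecidableEq α] [Fintype β] [DecidableEq β]

theorem card_cycleType_le_card_support (σ : Perm α) :
    σ.cycleType.card ≤ σ.support.card := by
  rw [← sum_cycleType]
  have h := Multiset.card_nsmul_le_sum (s := σ.cycleType) (a := 1)
    fun n hn => (one_lt_of_mem_cycleType hn).le
  simpa using h

theorem Equiv.Perm.Disjoint.cycleDefect_mul {σ τ : Perm α} (h : Disjoint σ τ) :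
    cycleDefect (σ * τ) = cycleDefect σ + cycleDefect τ := by
  have hσ := card_cycleType_le_card_support σ
  have hτ := card_cycleType_le_card_support τ
  simp only [cycleDefect, h.cycleType_mul, h.card_support_mul, Multiset.card_add]
  omega

theorem cycleDefect_extendDomain {p : β → Prop} [DecidablePred p] (f : α ≃ Subtype p)
    (σ : Perm α) : cycleDefect (σ.extendDomain f) = cycleDefect σ := by
  simp only [cycleDefect, cycleType_extendDomain, card_support_extend_domain]

theorem cycleDefect_optionCongr (σ : Perm α) :
    cycleDefect (optionCongr σ) = cycleDefect σ := by
  have h : optionCongr σ = σ.extendDomain (optionIsSomeEquiv α).symm := by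
    ext1 x
    cases x with
    | none => rw [extendDomain_apply_not_subtype] <;> simp
    | some a => rw [extendDomain_apply_subtype _ _ (by simp)]; simp [optionIsSomeEquiv]
  rw [h, cycleDefect_extendDomain]

theorem cycleDefect_permCongr (f : α ≃ β) (σ : Perm α) :
    cycleDefect (f.permCongr σ) = cycleDefect σ := by
  have h : f.permCongr σ =
      σ.extendDomain (f.trans (subtypeUnivEquiv (p := fun _ => True) fun _ => trivial).symm) := by
    ext1 x
    rw [extendDomain_apply_subtype _ _ trivial]
    simp [subtypeUnivEquiv]
  rw [h, cycleDefect_extendDomain]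

theorem cycleDefect_formPerm {l : List α} (hl : l.Nodup) (hn : 2 ≤ l.length) :
    cycleDefect l.formPerm = l.length - 1 := by
  rw [cycleDefect, (List.isCycle_formPerm hl hn).cycleType,
    List.support_formPerm_of_nodup l hl (by rintro x rfl; simp at hn),
    List.toFinset_card_of_nodup hl, Multiset.card_singleton]

/-- Multiplying by a transposition that involves exactly one new point
increases the defect by one. -/
theorem cycleDefect_swap_mul {σ : Perm α} {x y : α} (hxy : x ≠ y) (hx : σ x = x) :
    cycleDefect (swap x y * σ) = cycleDefect σ + 1 := by
  by_cases hy : σ y = y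
  · have hd : Disjoint (swap x y) σ := by
      intro z
      by_cases hzx : z = x
      · exact Or.inr (hzx ▸ hx)
      by_cases hzy : z = y
      · exact Or.inr (hzy ▸ hy)
      exact Or.inl (swap_apply_of_ne_of_ne hzx hzy)
    have hs : cycleDefect (swap x y) = 1 := by
      simpa using cycleDefect_formPerm (l := [x, y]) (by simpa using hxy) (by simp)
    rw [hd.cycleDefect_mul, hs, add_comm]
  · have hy' : y ∈ σ.support := mem_support.2 hy
    have hlen := (two_le_length_toList_iff_mem_support (p := σ)).2 hy'
    have hnd := nodup_toList σ y
    have hxl : x ∉ toList σ y := fun h =>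
      mem_support.1 ((mem_toList_iff.1 h).1.mem_support_iff.1 hy') hx
    have hc := cycleOf_mem_cycleFactorsFinset_iff.2 hy'
    have hd := disjoint_mul_inv_of_mem_cycleFactorsFinset hc
    have hf := formPerm_toList σ y
    obtain ⟨l, hl⟩ : ∃ l, toList σ y = y :: l := by
      have h0 := toList_getElem_zero σ y hy'
      cases h : toList σ y with
      | nil => simp [h] at hlen
      | cons a l => simp only [h, List.getElem_cons_zero] at h0; exact ⟨l, by rw [h0]⟩
    rw [hl] at hlen hnd hxl hf
    set ρ := σ * (cycleOf σ y)⁻¹ with hρ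
    have hσ : σ = cycleOf σ y * ρ := by
      rw [← hd.commute.eq, hρ, inv_mul_cancel_right]
    have hprod : swap x y * σ = (x :: y :: l).formPerm * ρ := by
      rw [List.formPerm_cons_cons, hf, mul_assoc, ← hσ]
    have hnd' : (x :: y :: l).Nodup := List.nodup_cons.2 ⟨hxl, hnd⟩
    have hd' : Disjoint (x :: y :: l).formPerm ρ := by
      intro z
      rw [List.formPerm_cons_cons, hf, mul_apply]
      rcases hd.symm z with hz | hz
      · by_cases hzx : z = x
        · right
          subst hzx
          rw [hρ, mul_apply, Perm.inv_eq_iff_eq.2 hz.symm, hx]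
        · have hzy : z ≠ y := by
            rintro rfl
            exact hy (by rwa [cycleOf_apply_self] at hz)
          left
          rw [hz, swap_apply_of_ne_of_ne hzx hzy]
      · exact Or.inr hz
    have hσd : cycleDefect σ = cycleDefect (y :: l).formPerm + cycleDefect ρ := by
      rw [hf, ← hd.symm.cycleDefect_mul, ← hσ]
    rw [hprod, hd'.cycleDefect_mul, hσd, cycleDefect_formPerm hnd hlen,
      cycleDefect_formPerm hnd' (by simp)]
    simp only [List.length_cons] at hlen ⊢
    omega

theorem sum_pow_cycleDefect_option {R : Type*} [CommSemiring R] (x : R) :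
    ∑ σ : Perm (Option α), x ^ cycleDefect σ =
      (1 + Fintype.card α * x) * ∑ σ : Perm α, x ^ cycleDefect σ := by
  have hsome (a : α) (σ : Perm α) :
      cycleDefect (swap none (some a) * optionCongr σ) = cycleDefect σ + 1 := by
    rw [cycleDefect_swap_mul (by simp) (by simp), cycleDefect_optionCongr]
  rw [← decomposeOption.symm.sum_comp, Fintype.sum_prod_type, Fintype.sum_option]
  simp only [decomposeOption_symm_apply, hsome, swap_self, ← Perm.one_def, one_mul,
    cycleDefect_optionCongr, Finset.sum_const, Finset.card_univ, nsmul_eq_mul, pow_succ,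
    ← Finset.sum_mul]
  ring

theorem sum_pow_cycleDefect_fin {R : Type*} [CommSemiring R] (x : R) (n : ℕ) :
    ∑ σ : Perm (Fin n), x ^ cycleDefect σ = ∏ k ∈ Finset.range n, (1 + k * x) := by
  induction n with
  | zero => simp [cycleDefect]
  | succ n ih =>
    rw [← (finSuccEquiv n).symm.permCongr.sum_comp]
    simp only [cycleDefect_permCongr]
    rw [sum_pow_cycleDefect_option, ih, Finset.prod_range_succ, Fintype.card_fin, mul_comm]

end CycleDefect

/-- For every constant `C > 0` there is a constant `B > 0` such that for all integers
`n > C`, `∑_{π ∈ S_n} (C/n²)^{t(π)} ≤ B·√n`. -/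
theorem sum_pow_t_quadratic_le (C : ℝ) (hC : 0 < C) :
    ∃ B : ℝ, 0 < B ∧ ∀ n : ℕ, C < (n : ℝ) →
      ∑ π : Equiv.Perm (Fin n), (C / (n : ℝ) ^ 2) ^ tPerm π ≤ B * Real.sqrt n := by
  refine ⟨Real.exp C, Real.exp_pos C, fun n hn => ?_⟩
  have hn0 : (0 : ℝ) < n := hC.trans hn
  have hn1 : (1 : ℝ) ≤ n := by exact_mod_cast Nat.cast_pos.1 hn0
  have hsqrt : 1 ≤ Real.sqrt n := Real.one_le_sqrt.2 hn1
  calc ∑ π : Equiv.Perm (Fin n), (C / (n : ℝ) ^ 2) ^ tPerm π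
      = ∏ k ∈ Finset.range n, (1 + k * (C / (n : ℝ) ^ 2)) := sum_pow_cycleDefect_fin _ n
    _ ≤ ∏ _k ∈ Finset.range n, Real.exp (C / n) := by
        refine Finset.prod_le_prod (fun k _ => by positivity) fun k hk => ?_
        have hkn : (k : ℝ) ≤ n := by exact_mod_cast (Finset.mem_range.1 hk).le
        calc 1 + k * (C / (n : ℝ) ^ 2) ≤ 1 + n * (C / (n : ℝ) ^ 2) := by gcongr
          _ = C / n + 1 := by field_simp; ring
          _ ≤ Real.exp (C / n) := Real.add_one_le_exp _
    _ = Real.exp C := by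
        rw [Finset.prod_const, Finset.card_range, ← Real.exp_nat_mul, mul_div_cancel₀ _ hn0.ne']
    _ ≤ Real.exp C * Real.sqrt n := le_mul_of_one_le_right (Real.exp_pos C).le hsqrt
end
end

section
/- There exists an integer N such that for all n ≥ N, every irreducible finite-dimensional complex representation V of S_n with dim V > e^{−√n·log n}·√(n!), and every permutation π ∈ S_n whose cycle type contains a part of size at least 8√n·log n, one has χ_V(π) = 0. -/
open CategoryTheory

noncomputable section

/-- The square of the dimension of a simple module over a finite-dimensional algebra `A` over an
algebraically closed field is at most the dimension of `A`. -/
lemma IsSimpleModule.finrank_sq_le (k A V : Type*) [Field k] [Ring A] [Algebra k A]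
    [AddCommGroup V] [Module k V] [Module A V] [IsScalarTower k A V] [IsSimpleModule A V]
    [FiniteDimensional k V] [IsAlgClosed k] [FiniteDimensional k A] :
    Module.finrank k V ^ 2 ≤ Module.finrank k A := by
  classical
  have hsurj : Function.Surjective (Algebra.lsmul k k V : A →ₐ[k] Module.End k V) := by
    intro f
    let F : Module.End (Module.End A V) V :=
      { toFun := f
        map_add' := f.map_add
        map_smul' := fun φ v => by
          obtain ⟨c, rfl⟩ := (IsSimpleModule.algebraMap_end_bijective_of_isAlgClosed k).2 φ
          simp }
    let b := Module.finBasis k V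
    obtain ⟨r, hr⟩ := jacobson_density F (Finset.univ.image b)
    refine ⟨r, b.ext fun i => ?_⟩
    exact (hr (b i) (by simp)).symm
  have := LinearMap.finrank_le_finrank_of_surjective
    (f := (Algebra.lsmul k k V : A →ₐ[k] Module.End k V).toLinearMap) hsurj
  rwa [Module.finrank_linearMap, ← sq] at this

namespace Representation

variable {k G V : Type*} [Field k] [Group G] [AddCommGroup V] [Module k V]

lemma IsIrreducible.finrank_sq_le_card [IsAlgClosed k] [Finite G] [FiniteDimensional k V]
    (ρ : Representation k G V) [ρ.IsIrreducible] :
    Module.finrank k V ^ 2 ≤ Nat.card G := by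
  have : Fintype G := Fintype.ofFinite G
  have : FiniteDimensional k ρ.asModule := ‹FiniteDimensional k V›
  have h := IsSimpleModule.finrank_sq_le k (MonoidAlgebra k G) ρ.asModule
  have h2 : Module.finrank k (MonoidAlgebra k G) = Nat.card G := by
    rw [Nat.card_eq_fintype_card]
    exact (MonoidAlgebra.coeffLinearEquiv k).finrank_eq.trans (Module.finrank_finsupp_self k)
  rw [h2] at h
  exact h

/-- Every nonzero invariant subspace contains a nonzero invariant subspace whose dimension squared
is at most the order of the group. -/
lemma exists_invariant_finrank_sq_le_card [IsAlgClosed k] [Finite G] [FiniteDimensional k V]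
    (ρ : Representation k G V) (W : Submodule k V) (hW : W ≠ ⊥)
    (hinv : ∀ g, ∀ v ∈ W, ρ g v ∈ W) :
    ∃ U ≤ W, U ≠ ⊥ ∧ (∀ g, ∀ v ∈ U, ρ g v ∈ U) ∧ Module.finrank k U ^ 2 ≤ Nat.card G := by
  obtain ⟨U, ⟨hUW, hU0, hUinv⟩, hmin⟩ := (wellFounded_lt (α := Submodule k V)).has_min
    {U | U ≤ W ∧ U ≠ ⊥ ∧ ∀ g, ∀ v ∈ U, ρ g v ∈ U} ⟨W, le_rfl, hW, hinv⟩
  refine ⟨U, hUW, hU0, hUinv, ?_⟩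
  let σ := (Subrepresentation.mk (ρ := ρ) U fun g v hv => hUinv g v hv).toRepresentation
  have hbot : (⊥ : Subrepresentation σ).toSubmodule = ⊥ := rfl
  have htop : (⊤ : Subrepresentation σ).toSubmodule = ⊤ := rfl
  have : σ.IsIrreducible := by
    refine { exists_pair_ne := ⟨⊥, ⊤, fun h => hU0 ?_⟩, eq_bot_or_eq_top := fun S => ?_ }
    · have h' := congrArg Subrepresentation.toSubmodule h
      rw [hbot, htop] at h'
      have : U = (⊤ : Submodule k U).map U.subtype := by simp
      rw [this, ← h', Submodule.map_bot]
    · by_cases hS : S.toSubmodule = ⊥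
      · exact Or.inl (Subrepresentation.toSubmodule_injective (hS.trans hbot.symm))
      right
      apply Subrepresentation.toSubmodule_injective
      rw [htop]
      have hle : S.toSubmodule.map U.subtype ≤ U := Submodule.map_subtype_le U _
      have hnlt := hmin (S.toSubmodule.map U.subtype) ⟨hle.trans hUW,
        fun h => hS (Submodule.map_injective_of_injective U.subtype_injective
          (by rw [h, Submodule.map_bot])), by
        rintro g _ ⟨v, hv, rfl⟩
        exact ⟨σ g v, S.apply_mem_toSubmodule g hv, rfl⟩⟩
      have heq : S.toSubmodule.map U.subtype = U := hle.eq_or_lt.resolve_right hnlt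
      refine Submodule.map_injective_of_injective U.subtype_injective ?_
      rw [heq]; simp
  exact IsIrreducible.finrank_sq_le_card σ

/-- If a representation has no proper invariant subspaces, its dimension is at most
the index of `L` times the dimension of any nonzero `L`-invariant subspace. -/
lemma finrank_le_index_mul_finrank [Finite G] [FiniteDimensional k V] (ρ : Representation k G V)
    (hirr : ∀ W : Submodule k V, (∀ g, ∀ v ∈ W, ρ g v ∈ W) → W = ⊥ ∨ W = ⊤)
    (L : Subgroup G) (U : Submodule k V) (hU : U ≠ ⊥) (hinv : ∀ g ∈ L, ∀ v ∈ U, ρ g v ∈ U) :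
    Module.finrank k V ≤ L.index * Module.finrank k U := by
  have : Fintype (G ⧸ L) := Fintype.ofFinite _
  let Φ : ((G ⧸ L) → U) →ₗ[k] V :=
    ∑ q : G ⧸ L, (ρ q.out) ∘ₗ U.subtype ∘ₗ LinearMap.proj q
  let W : Submodule k V := ⨆ g : G, U.map (ρ g)
  have hW : W = ⊤ := by
    refine (hirr W fun g v hv => ?_).resolve_left fun h => hU ?_
    · have : W ≤ W.comap (ρ g) := by
        refine iSup_le fun h => ?_
        rintro _ ⟨u, hu, rfl⟩
        rw [Submodule.mem_comap, ← Module.End.mul_apply, ← map_mul]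
        exact Submodule.mem_iSup_of_mem (g * h) ⟨u, hu, rfl⟩
      exact this hv
    · rw [eq_bot_iff, ← h]
      intro u hu
      exact Submodule.mem_iSup_of_mem 1 ⟨u, hu, by simp⟩
  have hΦ : Function.Surjective Φ := by
    rw [← LinearMap.range_eq_top, eq_top_iff, ← hW]
    refine iSup_le fun g => ?_
    rintro _ ⟨u, hu, rfl⟩
    have hmem : (g : G ⧸ L).out⁻¹ * g ∈ L := by
      rw [← QuotientGroup.eq]; simp
    classical
    refine ⟨Pi.single (g : G ⧸ L) ⟨_, hinv _ hmem u hu⟩, ?_⟩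
    simp only [Φ, LinearMap.sum_apply, LinearMap.comp_apply, LinearMap.proj_apply]
    rw [Finset.sum_eq_single (g : G ⧸ L)]
    · simp [← Module.End.mul_apply, ← map_mul]
    · intro q _ hq
      simp [Pi.single_eq_of_ne hq]
    · simp
  have h := LinearMap.finrank_le_finrank_of_surjective hΦ
  rwa [Module.finrank_pi_fintype, Finset.sum_const, Finset.card_univ, smul_eq_mul,
    ← Nat.card_eq_fintype_card] at h

/-- Frobenius reciprocity bound: if the `χ`-isotypic operator of `H` does not vanish on an
irreducible representation, and every element of `L` is a product of an element of `H` and an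
element of a subgroup `M` commuting with `H`, then the dimension is controlled by `L` and `M`. -/
lemma finrank_mul_card_sq_le [IsAlgClosed k] [Finite G] [FiniteDimensional k V]
    (ρ : Representation k G V)
    (hirr : ∀ W : Submodule k V, (∀ g, ∀ v ∈ W, ρ g v ∈ W) → W = ⊥ ∨ W = ⊤)
    (H M L : Subgroup G) [Fintype H] (χ : H →* ℤˣ)
    (hcomm : ∀ h ∈ H, ∀ m ∈ M, h * m = m * h)
    (hL : ∀ l ∈ L, ∃ h ∈ H, ∃ m ∈ M, l = h * m)
    (hne : ∑ h : H, ((χ h : ℤ) : k) • ρ h ≠ 0) :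
    (Module.finrank k V * Nat.card L) ^ 2 ≤ Nat.card G ^ 2 * Nat.card M := by
  set T : Module.End k V := ∑ h : H, ((χ h : ℤ) : k) • ρ h with hT
  have hχ : ∀ h : H, ((χ h : ℤ) : k) * ((χ h : ℤ) : k) = 1 := by
    intro h
    rw [← Int.cast_mul, ← Units.val_mul, Int.units_mul_self]; simp
  let W : Submodule k V :=
    { carrier := {v | ∀ h : H, ρ h v = ((χ h : ℤ) : k) • v}
      add_mem' := fun {a b} ha hb h => by rw [map_add, ha h, hb h, smul_add]
      zero_mem' := fun h => by simp
      smul_mem' := fun c x hx h => by rw [map_smul, hx h, smul_comm] }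
  have hTW : ∀ v, T v ∈ W := by
    intro v h
    have h1 : ρ h * T = ((χ h : ℤ) : k) • T := by
      rw [hT, Finset.mul_sum, Finset.smul_sum]
      refine Fintype.sum_equiv (Equiv.mulLeft h) _ _ fun x => ?_
      simp only [Equiv.coe_mulLeft]
      rw [mul_smul_comm, ← map_mul, smul_smul, map_mul χ, Units.val_mul, Int.cast_mul,
        ← mul_assoc, hχ, one_mul, Subgroup.coe_mul]
    exact congrArg (fun f : Module.End k V => f v) h1
  have hW : W ≠ ⊥ := by
    intro h
    apply hne
    ext v
    have := hTW v
    rw [h] at this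
    simpa using this
  obtain ⟨U, hUW, hU0, hUinv, hUcard⟩ := exists_invariant_finrank_sq_le_card
    (ρ.comp M.subtype) W hW (by
      intro m v hv h
      change ρ h (ρ m v) = _ • ρ m v
      rw [← Module.End.mul_apply, ← map_mul, hcomm h h.2 m m.2, map_mul, Module.End.mul_apply,
        hv h, map_smul])
  have hdim := finrank_le_index_mul_finrank ρ hirr L U hU0 (by
    intro l hl v hv
    obtain ⟨h, hh, m, hm, rfl⟩ := hL l hl
    rw [map_mul, Module.End.mul_apply]
    have hmv := hUinv ⟨m, hm⟩ v hv
    rw [show ρ h (ρ m v) = _ from hUW hmv ⟨h, hh⟩]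
    exact U.smul_mem _ hmv)
  calc (Module.finrank k V * Nat.card L) ^ 2
      ≤ (L.index * Module.finrank k U * Nat.card L) ^ 2 := by gcongr
    _ = (Nat.card L * L.index) ^ 2 * Module.finrank k U ^ 2 := by ring
    _ ≤ Nat.card G ^ 2 * Nat.card M := by
      rw [Subgroup.card_mul_index]; gcongr

end Representation

/-- A simple finite-dimensional representation has no proper nonzero invariant subspaces. -/
lemma FDRep.eq_bot_or_eq_top_of_simple {k : Type} {G : Type} [Field k] [Group G] (V : FDRep k G)
    [Simple V] (W : Submodule k V) (hW : ∀ g, ∀ v ∈ W, V.ρ g v ∈ W) : W = ⊥ ∨ W = ⊤ := by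
  let σ := (Subrepresentation.mk (ρ := V.ρ) W fun g v hv => hW g v hv).toRepresentation
  let f : FDRep.of σ ⟶ V := ⟨FGModuleCat.ofHom W.subtype, fun g => by ext v; rfl⟩
  have : Mono f := ConcreteCategory.mono_of_injective f W.subtype_injective
  by_cases hf : f = 0
  · left
    rw [eq_bot_iff]
    intro w hw
    have h : f.hom.hom.hom ⟨w, hw⟩ = 0 := by rw [hf]; rfl
    exact h
  · right
    have : IsIso f := isIso_of_mono_of_nonzero hf
    rw [eq_top_iff]
    intro v _
    have h := (FDRep.isoToLinearEquiv (asIso f)).surjective v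
    obtain ⟨w, hw⟩ := h
    have : (W.subtype w) = v := hw
    rw [← this]
    exact w.2

namespace Equiv.Perm

variable {α : Type} [Fintype α] [DecidableEq α]

/-- The sign of the restriction of `g` to `B` if `B` is `g`-stable, and zero otherwise. -/
def signOn (B : Finset α) (g : Perm α) : ℤ :=
  if h : ∀ x, g x ∈ B ↔ x ∈ B then sign (g.subtypePerm h) else 0

lemma signOn_eq_sign {B : Finset α} {g : Perm α} (p : Perm α) (h : ∀ x, g x ∈ B ↔ x ∈ B)
    (hp : ∀ x ∈ B, p x = g x) (hp' : ∀ x ∉ B, p x = x) : signOn B g = sign p := by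
  rw [signOn, dif_pos h, ← sign_ofSubtype]
  congr 2
  ext x
  by_cases hx : x ∈ B
  · rw [ofSubtype_apply_of_mem _ hx, hp x hx, subtypePerm_apply]
  · rw [ofSubtype_apply_of_not_mem _ hx, hp' x hx]

omit [DecidableEq α] in
lemma SameCycle.mem_iff_mem_of_stable {B : Finset α} {g : Perm α} (h : ∀ x, g x ∈ B ↔ x ∈ B)
    {d x : α} (hdx : g.SameCycle d x) : x ∈ B ↔ d ∈ B := by
  obtain ⟨i, -, rfl⟩ := hdx.exists_pow_eq'
  induction i with
  | zero => simp
  | succ i ih =>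
    rw [pow_succ', mul_apply, h]
    exact ih ⟨i, by simp⟩

lemma sign_cycleOf (g : Perm α) (d : α) :
    (sign (g.cycleOf d) : ℤ) = -(-1) ^ (Finset.univ.filter (g.SameCycle d)).card := by
  by_cases hd : g d = d
  · have : Finset.univ.filter (g.SameCycle d) = {d} := by
      ext x
      simp only [Finset.mem_filter, Finset.mem_univ, true_and, Finset.mem_singleton]
      exact ⟨fun h => (h.eq_of_left hd).symm, fun h => h ▸ SameCycle.refl g d⟩
    rw [(cycleOf_eq_one_iff g).2 hd, this]
    simp
  · have : Finset.univ.filter (g.SameCycle d) = (g.cycleOf d).support := by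
      ext x
      rw [mem_support_cycleOf_iff, Finset.mem_filter, mem_support]
      simp [hd]
    rw [(isCycle_cycleOf g hd).sign, this]
    simp

lemma signOn_union_cycle {B : Finset α} {g : Perm α} (h : ∀ x, g x ∈ B ↔ x ∈ B) {d : α}
    (hd : d ∉ B) :
    signOn (B ∪ Finset.univ.filter (g.SameCycle d)) g = signOn B g * sign (g.cycleOf d) := by
  have hq : ∀ x ∈ B, ofSubtype (g.subtypePerm h) x = g x := fun x hx => by
    rw [ofSubtype_apply_of_mem _ hx, subtypePerm_apply]
  have hq' : ∀ x ∉ B, ofSubtype (g.subtypePerm h) x = x := fun x hx =>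
    ofSubtype_apply_of_not_mem _ hx
  have hdisj : ∀ x ∈ B, ¬ g.SameCycle d x := fun x hx hs =>
    hd ((hs.mem_iff_mem_of_stable h).1 hx)
  rw [signOn_eq_sign _ h hq hq', signOn_eq_sign (ofSubtype (g.subtypePerm h) * g.cycleOf d)]
  · simp
  · intro x
    simp [h, sameCycle_apply_right]
  · intro x hx
    rw [mul_apply, cycleOf_apply]
    split_ifs with hs
    · exact hq' _ fun hx' => hdisj x ((h x).1 hx') hs
    · exact hq x (by simpa [hs] using hx)
  · intro x hx
    simp only [Finset.mem_union, Finset.mem_filter, Finset.mem_univ, true_and, not_or] at hx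
    rw [mul_apply, cycleOf_apply, if_neg hx.2, hq' x hx.1]

/-- The signed count of stable sets containing `a` vanishes when `g` has another cycle in `A`. -/
lemma sum_signOn_eq_zero {A : Finset α} {g : Perm α} (hg : ∀ x ∉ A, g x = x) {a d : α}
    (hd : d ∈ A) (had : ¬ g.SameCycle d a) :
    ∑ B ∈ A.powerset with a ∈ B, (-1) ^ B.card * signOn B g = 0 := by
  set D := Finset.univ.filter (g.SameCycle d) with hD
  have memD : ∀ x, x ∈ D ↔ g.SameCycle d x := fun x => by simp [hD]
  have hDA : D ⊆ A := by
    intro x hx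
    by_contra hxA
    exact hxA ((((memD x).1 hx).eq_of_right (hg x hxA)) ▸ hd)
  have hdD : d ∈ D := (memD d).2 (SameCycle.refl g d)
  have haD : a ∉ D := fun h => had ((memD a).1 h)
  have hDst : ∀ x, g x ∈ D ↔ x ∈ D := fun x => by simp [memD, sameCycle_apply_right]
  have key : ∀ B : Finset α, (∀ x, g x ∈ B ↔ x ∈ B) → d ∉ B →
      (-1) ^ (B ∪ D).card * signOn (B ∪ D) g = -((-1) ^ B.card * signOn B g) := by
    intro B hB hdB
    have hdis : _root_.Disjoint B D := Finset.disjoint_left.2 fun x hx hxD =>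
      hdB ((((memD x).1 hxD).mem_iff_mem_of_stable hB).1 hx)
    rw [signOn_union_cycle hB hdB, sign_cycleOf, Finset.card_union_of_disjoint hdis, pow_add]
    have : ((-1 : ℤ) ^ D.card) * (-1) ^ D.card = 1 := by
      rw [← mul_pow]; simp
    linear_combination (-(-1) ^ B.card * signOn B g) * this
  have hsub : ∀ B : Finset α, (∀ x, g x ∈ B ↔ x ∈ B) → d ∈ B → D ⊆ B := fun B hB hdB x hx =>
    (((memD x).1 hx).mem_iff_mem_of_stable hB).2 hdB
  rw [← Finset.sum_filter_of_ne (p := fun B => ∀ x, g x ∈ B ↔ x ∈ B)]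
  swap
  · intro B _ hB
    by_contra hst
    exact hB (by rw [signOn, dif_neg hst, mul_zero])
  refine Finset.sum_involution (fun B _ => if d ∈ B then B \ D else B ∪ D) ?_ ?_ ?_ ?_
  · intro B hB
    have hst := (Finset.mem_filter.1 hB).2
    split_ifs with hdB
    · have h := key (B \ D) (fun x => by simp [hst, hDst]) (by simp [hdD])
      rw [Finset.sdiff_union_of_subset (hsub B hst hdB)] at h
      rw [h]; ring
    · rw [key B hst hdB]; ring
  · intro B _ _ h
    have : d ∈ (if d ∈ B then B \ D else B ∪ D) ↔ d ∉ B := by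
      split_ifs with hdB <;> simp [hdB, hdD]
    rw [h] at this
    tauto
  · intro B hB
    simp only [Finset.mem_filter, Finset.mem_powerset] at hB ⊢
    obtain ⟨⟨hBA, haB⟩, hst⟩ := hB
    split_ifs with hdB
    · exact ⟨⟨Finset.sdiff_subset.trans hBA, by simp [haB, haD]⟩, fun x => by simp [hst, hDst]⟩
    · exact ⟨⟨Finset.union_subset hBA hDA, by simp [haB]⟩, fun x => by simp [hst, hDst]⟩
  · intro B hB
    have hst := (Finset.mem_filter.1 hB).2
    by_cases hdB : d ∈ B
    · simp [hdB, hdD, Finset.union_eq_left.2 (hsub B hst hdB)]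
    · have hdis : _root_.Disjoint B D := Finset.disjoint_left.2 fun x hx hxD =>
        hdB ((((memD x).1 hxD).mem_iff_mem_of_stable hst).1 hx)
      simp [hdB, hdD, Finset.union_sdiff_cancel_right hdis]

/-- The signed count of stable sets containing `a` for a cycle with support `A`. -/
lemma sum_signOn_support {A : Finset α} {g : Perm α} (hg : g.IsCycle) (hA : g.support = A) {a : α}
    (ha : a ∈ A) :
    ∑ B ∈ A.powerset with a ∈ B, (-1) ^ B.card * signOn B g = -1 := by
  rw [Finset.sum_eq_single A]
  · rw [signOn_eq_sign g (fun x => by rw [← hA, apply_mem_support]) (fun _ _ => rfl)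
      (fun x hx => by rwa [← hA, notMem_support] at hx), hg.sign, hA]
    have : ((-1 : ℤ) ^ A.card) * (-1) ^ A.card = 1 := by
      rw [← mul_pow]; simp
    push_cast
    linear_combination -this
  · intro B hB hne
    simp only [Finset.mem_filter, Finset.mem_powerset] at hB
    rw [signOn, dif_neg, mul_zero]
    intro hst
    refine hne (hB.1.antisymm fun x hx => ?_)
    rw [← hA, mem_support] at ha hx
    exact ((hg.sameCycle ha hx).mem_iff_mem_of_stable hst).2 hB.2
  · simp [ha]

/-- If `g` is supported in `A` and all points of `A` lie in one cycle, then `g` is a cycle with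
support `A`. -/
lemma isCycle_and_support_eq_of_sameCycle {A : Finset α} {g : Perm α} (hg : ∀ x ∉ A, g x = x)
    (hA : 1 < A.card) {a : α} (ha : a ∈ A) (h : ∀ d ∈ A, g.SameCycle d a) :
    g.IsCycle ∧ g.support = A := by
  have hmem : ∀ x ∈ A, g x ≠ x := by
    intro x hx hfix
    have hxa := (h x hx).eq_of_left hfix
    obtain ⟨y, hy, hyx⟩ := Finset.exists_mem_ne hA x
    exact hyx ((h y hy).eq_of_right (hxa ▸ hfix) |>.trans hxa.symm)
  have hsupp : g.support = A := by
    ext x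
    rw [mem_support]
    exact ⟨fun hx => by by_contra hxA; exact hx (hg x hxA), hmem x⟩
  refine ⟨⟨a, hmem a ha, fun y hy => (h y ?_).symm⟩, hsupp⟩
  rwa [← hsupp, mem_support]

/-- The permutations supported in `A` which preserve `B`. -/
def blockSubgroup (A B : Finset α) : Subgroup (Perm α) where
  carrier := {g | (∀ x ∉ A, g x = x) ∧ ∀ x, g x ∈ B ↔ x ∈ B}
  mul_mem' := fun {g h} hg hh =>
    ⟨fun x hx => by rw [mul_apply, hh.1 x hx, hg.1 x hx], fun x => by
      rw [mul_apply, hg.2, hh.2]⟩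
  one_mem' := by simp
  inv_mem' := fun {g} hg =>
    ⟨fun x hx => by rw [inv_eq_iff_eq, hg.1 x hx], fun x => by
      rw [← hg.2 (g⁻¹ x), ← mul_apply, mul_inv_cancel, one_apply]⟩

/-- The sign of the action on `B`. -/
def blockSign (A B : Finset α) : blockSubgroup A B →* ℤˣ where
  toFun g := sign (g.1.subtypePerm (p := (· ∈ B)) g.2.2)
  map_one' := (congrArg sign (subtypePerm_one (· ∈ B))).trans sign_one
  map_mul' g h := by
    rw [← sign_mul, subtypePerm_mul]
    rfl

lemma blockSign_eq_signOn (A B : Finset α) (g : blockSubgroup A B) :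
    (blockSign A B g : ℤ) = signOn B g.1 := by
  rw [signOn, dif_pos g.2.2]
  rfl

lemma signOn_eq_zero_of_notMem {A B : Finset α} {g : Perm α} (hg : ∀ x ∉ A, g x = x)
    (h : g ∉ blockSubgroup A B) : signOn B g = 0 := by
  rw [signOn, dif_neg fun hst => h ⟨hg, hst⟩]

/-- The signed count of stable sets through `a` detects the cycles with support `A`. -/
lemma sum_signOn {A : Finset α} {g : Perm α} (hg : ∀ x ∉ A, g x = x)
    (hA : 1 < A.card) {a : α} (ha : a ∈ A) :
    ∑ B ∈ A.powerset with a ∈ B, (-1) ^ B.card * signOn B g =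
      open Classical in if g.IsCycle ∧ g.support = A then -1 else 0 := by
  split_ifs with h
  · exact sum_signOn_support h.1 h.2 ha
  · by_contra hne
    refine h (isCycle_and_support_eq_of_sameCycle hg hA ha fun d hd => ?_)
    by_contra hda
    exact hne (sum_signOn_eq_zero hg hd hda)

/-- If the character of `ρ` does not vanish at `π` and `c` is a cycle of `π`, then some
sign-isotypic operator for a block subgroup of the support of `c` does not vanish. -/
lemma exists_blockSign_sum_ne_zero {V : Type*} [AddCommGroup V] [Module ℂ V]
    (ρ : Representation ℂ (Perm α) V) {π c : Perm α} (hc : c ∈ π.cycleFactorsFinset)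
    (hπ : LinearMap.trace ℂ V (ρ π) ≠ 0) :
    ∃ B ⊆ c.support, open Classical in
      ∑ h : blockSubgroup c.support B, ((blockSign c.support B h : ℤ) : ℂ) • ρ h ≠ 0 := by
  classical
  by_contra! hcon
  have hcyc := (mem_cycleFactorsFinset_iff.1 hc).1
  obtain ⟨a, ha⟩ := hcyc.nonempty_support
  set A := c.support with hA
  have hdisj := disjoint_mul_inv_of_mem_cycleFactorsFinset hc
  set σ := π * c⁻¹ with hσ
  have hπσ : π = σ * c := by simp [hσ]
  let φ : Perm α → ℂ := fun g => LinearMap.trace ℂ V (ρ (σ * g))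
  have hφ : ∀ g : Perm α, g.IsCycle → g.support = A → φ g = φ c := by
    intro g hg hgA
    have hdg : σ.Disjoint g := by
      rw [disjoint_iff_disjoint_support, hgA, hA, ← disjoint_iff_disjoint_support]
      exact hdisj
    obtain ⟨τ, hτ⟩ := isConj_iff.1 (isConj_of_cycleType_eq (σ := σ * c) (τ := σ * g) (by
      rw [hdg.cycleType_mul, hdisj.cycleType_mul, hg.cycleType, hcyc.cycleType, hgA]))
    simp only [φ, ← hτ]
    exact Representation.char_conj ρ (σ * c) τ
  let P : Finset (Perm α) := Finset.univ.filter fun g => ∀ x ∉ A, g x = x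
  have hB : ∀ B ⊆ A, ∑ g ∈ P, (signOn B g : ℂ) * φ g = 0 := by
    intro B hBA
    have h1 := congrArg (fun T : Module.End ℂ V => LinearMap.trace ℂ V (ρ σ * T)) (hcon B hBA)
    simp only [mul_zero, map_zero, Finset.mul_sum, map_sum, mul_smul_comm, map_smul,
      ← map_mul, smul_eq_mul, blockSign_eq_signOn] at h1
    rw [← h1]
    have hP : ∀ g, g ∈ P.filter (· ∈ blockSubgroup A B) ↔ g ∈ blockSubgroup A B := by
      intro g
      simp only [P, Finset.mem_filter, Finset.mem_univ, true_and, and_iff_right_iff_imp]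
      exact fun hg => hg.1
    refine Eq.trans ?_ (Finset.sum_subtype _ hP fun g => (signOn B g : ℂ) * φ g)
    refine (Finset.sum_filter_of_ne fun g hg hne => ?_).symm
    by_contra hgB
    exact hne (by rw [signOn_eq_zero_of_notMem (Finset.mem_filter.1 hg).2 hgB]; simp)
  have hsum : ∑ g ∈ P, (∑ B ∈ A.powerset with a ∈ B, (-1) ^ B.card * signOn B g : ℤ) * φ g
      = 0 := by
    simp only [Int.cast_sum, Finset.sum_mul]
    rw [Finset.sum_comm]
    refine Finset.sum_eq_zero fun B hB' => ?_
    simp only [Int.cast_mul, mul_assoc]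
    rw [← Finset.mul_sum, hB B (Finset.mem_powerset.1 (Finset.mem_filter.1 hB').1), mul_zero]
  have hval : ∀ g ∈ P, ((∑ B ∈ A.powerset with a ∈ B, (-1) ^ B.card * signOn B g : ℤ) : ℂ) * φ g
      = if g.IsCycle ∧ g.support = A then -φ c else 0 := by
    intro g hg
    rw [sum_signOn (Finset.mem_filter.1 hg).2 hcyc.two_le_card_support ha]
    split_ifs with h
    · rw [hφ g h.1 h.2]; simp
    · simp
  rw [Finset.sum_congr rfl hval, ← Finset.sum_filter, Finset.sum_const, smul_neg, neg_eq_zero,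
    smul_eq_zero] at hsum
  rcases hsum with h | h
  · rw [Finset.card_eq_zero] at h
    have : c ∈ P.filter fun g => g.IsCycle ∧ g.support = A := by
      simp only [P, Finset.mem_filter, Finset.mem_univ, true_and]
      exact ⟨fun x hx => by rwa [hA, notMem_support] at hx, hcyc, hA.symm⟩
    rw [h] at this
    simp at this
  · exact hπ (by rw [hπσ]; exact h)

/-- The permutations fixing every point of `A`. -/
def pointwiseFixing (A : Finset α) : Subgroup (Perm α) where
  carrier := {g | ∀ x ∈ A, g x = x}
  mul_mem' := fun {g h} hg hh x hx => by rw [mul_apply, hh x hx, hg x hx]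
  one_mem' := by simp
  inv_mem' := fun {g} hg x hx => by rw [inv_eq_iff_eq, hg x hx]

/-- The permutations preserving both `A` and `B`. -/
def setwiseStabilizing (A B : Finset α) : Subgroup (Perm α) where
  carrier := {g | (∀ x, g x ∈ A ↔ x ∈ A) ∧ ∀ x, g x ∈ B ↔ x ∈ B}
  mul_mem' := fun {g h} hg hh =>
    ⟨fun x => by rw [mul_apply, hg.1, hh.1], fun x => by rw [mul_apply, hg.2, hh.2]⟩
  one_mem' := by simp
  inv_mem' := fun {g} hg =>
    ⟨fun x => by rw [← hg.1 (g⁻¹ x), ← mul_apply, mul_inv_cancel, one_apply], fun x => by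
      rw [← hg.2 (g⁻¹ x), ← mul_apply, mul_inv_cancel, one_apply]⟩

lemma card_pointwiseFixing (A : Finset α) :
    Nat.card (pointwiseFixing A) = (Fintype.card α - A.card).factorial := by
  have e : pointwiseFixing A ≃ Perm {x // x ∉ A} :=
    (Equiv.subtypeEquivRight fun g => by
      change (∀ x ∈ A, g x = x) ↔ ∀ x, ¬ x ∉ A → g x = x
      simp only [not_not]).trans (Perm.subtypeEquivSubtypePerm (· ∉ A)).symm
  rw [Nat.card_congr e, Nat.card_eq_fintype_card, Fintype.card_perm]
  congr 1
  rw [Fintype.card_subtype_compl, Fintype.card_coe]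

lemma card_setwiseStabilizing {A B : Finset α} (hBA : B ⊆ A) :
    Nat.card (setwiseStabilizing A B) = B.card.factorial * (A.card - B.card).factorial *
      (Fintype.card α - A.card).factorial := by
  let f : α → Fin 3 := fun x => if x ∈ B then 0 else if x ∈ A then 1 else 2
  have e : setwiseStabilizing A B ≃ {g : Perm α // f ∘ g = f} :=
    Equiv.subtypeEquivRight fun g => by
      have h0 : ∀ x, x ∈ B ↔ f x = 0 := fun x => by simp only [f]; split_ifs <;> simp_all
      have h1 : ∀ x, x ∈ A ↔ f x ≠ 2 := fun x => by
        have := @hBA x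
        simp only [f]; split_ifs <;> simp_all
      constructor
      · rintro ⟨hA, hB⟩
        ext1 x
        simp only [Function.comp_apply, f, hA, hB]
      · intro h
        have h' : ∀ x, f (g x) = f x := fun x => congrFun h x
        exact ⟨fun x => by rw [h1, h1, h'], fun x => by rw [h0, h0, h']⟩
  rw [Nat.card_congr e, Nat.card_eq_fintype_card, DomMulAct.stabilizer_card, Fin.prod_univ_three]
  congr
  · rw [Fintype.card_subtype]; congr 1; ext x; simp only [f, Finset.mem_filter]; split_ifs <;> simp_all
  · rw [Fintype.card_subtype, ← Finset.card_sdiff_of_subset hBA]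
    congr 1; ext x; simp only [f, Finset.mem_filter]; split_ifs <;> simp_all
  · rw [Fintype.card_subtype, ← Finset.card_compl]
    congr 1; ext x; have := @hBA x; simp only [f, Finset.mem_filter]; split_ifs <;> simp_all

omit [Fintype α] in
lemma exists_mul_of_mem_setwiseStabilizing {A B : Finset α} {l : Perm α}
    (hl : l ∈ setwiseStabilizing A B) :
    ∃ h ∈ blockSubgroup A B, ∃ m ∈ pointwiseFixing A, l = h * m := by
  have hin : ∀ x ∈ A, ofSubtype (l.subtypePerm hl.1) x = l x := fun x hx => by
    rw [ofSubtype_apply_of_mem _ hx, subtypePerm_apply]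
  have hout : ∀ x ∉ A, ofSubtype (l.subtypePerm hl.1) x = x := fun x hx =>
    ofSubtype_apply_of_not_mem _ hx
  refine ⟨ofSubtype (l.subtypePerm hl.1), ⟨hout, fun x => ?_⟩,
    (ofSubtype (l.subtypePerm hl.1))⁻¹ * l, fun x hx => ?_, by simp⟩
  · by_cases hx : x ∈ A
    · rw [hin x hx, hl.2]
    · rw [hout x hx]
  · rw [mul_apply, inv_eq_iff_eq, hin x hx]

omit [Fintype α] in
lemma blockSubgroup_commute_pointwiseFixing {A B : Finset α} {h m : Perm α}
    (hh : h ∈ blockSubgroup A B) (hm : m ∈ pointwiseFixing A) : h * m = m * h := by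
  have : h.Disjoint m := fun x => by
    by_cases hx : x ∈ A
    · exact Or.inr (hm x hx)
    · exact Or.inl (hh.1 x hx)
  exact this.commute

/-- An irreducible representation of the symmetric group whose character does not vanish at a
permutation with a cycle of length `k` has small dimension. -/
lemma finrank_sq_mul_factorial_sq_le {V : Type*} [AddCommGroup V] [Module ℂ V]
    [FiniteDimensional ℂ V] (ρ : Representation ℂ (Perm α) V)
    (hirr : ∀ W : Submodule ℂ V, (∀ g, ∀ v ∈ W, ρ g v ∈ W) → W = ⊥ ∨ W = ⊤)
    {π c : Perm α} (hc : c ∈ π.cycleFactorsFinset) (hπ : LinearMap.trace ℂ V (ρ π) ≠ 0) :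
    (Module.finrank ℂ V * c.support.card.factorial) ^ 2 ≤
      (4 * Fintype.card α) ^ c.support.card * (Fintype.card α).factorial := by
  classical
  obtain ⟨B, hBA, hB⟩ := exists_blockSign_sum_ne_zero ρ hc hπ
  have h := Representation.finrank_mul_card_sq_le ρ hirr (blockSubgroup c.support B)
    (pointwiseFixing c.support) (setwiseStabilizing c.support B) (blockSign c.support B)
    (fun h hh m hm => blockSubgroup_commute_pointwiseFixing hh hm)
    (fun l hl => exists_mul_of_mem_setwiseStabilizing hl) hB
  rw [card_pointwiseFixing, card_setwiseStabilizing hBA, Nat.card_eq_fintype_card,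
    Fintype.card_perm] at h
  set n := Fintype.card α
  set k := c.support.card
  set j := B.card
  have hjk : j ≤ k := Finset.card_le_card hBA
  have hkn : k ≤ n := Finset.card_le_univ _
  have h1 : k.factorial ≤ 2 ^ k * (j.factorial * (k - j).factorial) := by
    rw [← Nat.choose_mul_factorial_mul_factorial hjk, mul_assoc]
    gcongr
    exact Nat.choose_le_two_pow k j
  have h2 : n.factorial ≤ n ^ k * (n - k).factorial := by
    have := Nat.factorial_mul_descFactorial hkn
    rw [← this, mul_comm]
    gcongr
    exact Nat.descFactorial_le_pow n k
  set d := Module.finrank ℂ V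
  set q := (n - k).factorial
  have hq : 0 < q := Nat.factorial_pos _
  refine le_of_mul_le_mul_right ?_ (pow_pos hq 2)
  calc (d * k.factorial) ^ 2 * q ^ 2
      ≤ (d * (2 ^ k * (j.factorial * (k - j).factorial))) ^ 2 * q ^ 2 := by gcongr
    _ = 4 ^ k * (d * (j.factorial * (k - j).factorial * q)) ^ 2 := by
      rw [show 4 ^ k = 2 ^ k * 2 ^ k by rw [← mul_pow]; rfl]; ring
    _ ≤ 4 ^ k * (n.factorial ^ 2 * q) := by gcongr
    _ = 4 ^ k * n.factorial * q * n.factorial := by ring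
    _ ≤ 4 ^ k * n.factorial * q * (n ^ k * q) := by gcongr
    _ = (4 * n) ^ k * n.factorial * q ^ 2 := by rw [mul_pow]; ring

end Equiv.Perm

/-- For `k ≥ 8 √n log n` the factorial `k!` exceeds `(4 n) ^ (k / 2)` by a factor at least
`exp (√n log n)`. -/
lemma le_exp_mul_sqrt_factorial {n k d : ℕ} (hn : 9 ≤ n)
    (hk : 8 * Real.sqrt n * Real.log n ≤ (k : ℝ))
    (h : (d * k.factorial) ^ 2 ≤ (4 * n) ^ k * n.factorial) :
    (d : ℝ) ≤ Real.exp (-(Real.sqrt n * Real.log n)) * Real.sqrt n.factorial := by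
  have hn' : (9 : ℝ) ≤ n := by exact_mod_cast hn
  have hlog : 2 ≤ Real.log n := by
    rw [Real.le_log_iff_exp_le (by linarith)]
    have h1 := Real.exp_one_lt_d9
    have h0 := Real.exp_pos 1
    have : Real.exp 2 = Real.exp 1 * Real.exp 1 := by rw [← Real.exp_add]; norm_num
    rw [this]
    nlinarith
  set s := Real.sqrt n with hs
  have hs0 : 0 < s := Real.sqrt_pos.2 (by linarith)
  have hss : s ^ 2 = n := Real.sq_sqrt (by linarith)
  have hsl : 0 < s * Real.log n := by positivity
  have hk0 : (0 : ℝ) < k := by nlinarith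
  have hkf : ((k : ℝ) / Real.exp 1) ^ k ≤ k.factorial := by
    have := Real.pow_div_factorial_le_exp (k : ℝ) hk0.le k
    rw [div_pow, ← Real.exp_nat_mul, mul_one, div_le_iff₀ (Real.exp_pos _)]
    rw [div_le_iff₀ (by positivity)] at this
    linarith
  have h2 : (d : ℝ) * k.factorial ≤ (2 * s) ^ k * Real.sqrt n.factorial := by
    refine le_of_sq_le_sq ?_ (by positivity)
    have : ((d : ℝ) * k.factorial) ^ 2 ≤ (4 * n) ^ k * n.factorial := by exact_mod_cast h
    refine this.trans_eq ?_
    rw [mul_pow ((2 * s) ^ k), Real.sq_sqrt (by positivity), ← pow_mul, mul_comm k 2, pow_mul,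
      mul_pow 2 s, hss]
    norm_num
  have h3 : 2 * s ≤ Real.exp (-1) * (k / Real.exp 1) := by
    have h1 := Real.exp_one_lt_d9
    have h0 := Real.exp_pos 1
    rw [Real.exp_neg, inv_mul_eq_div, div_div, le_div_iff₀ (by positivity)]
    have : Real.exp 1 * Real.exp 1 ≤ 8 := by nlinarith
    nlinarith
  have h4 : (d : ℝ) * k.factorial ≤ (Real.exp (-k) * Real.sqrt n.factorial) * k.factorial := by
    calc (d : ℝ) * k.factorial ≤ (2 * s) ^ k * Real.sqrt n.factorial := h2
      _ ≤ (Real.exp (-1) * (k / Real.exp 1)) ^ k * Real.sqrt n.factorial := by gcongr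
      _ = Real.exp (-k) * (k / Real.exp 1) ^ k * Real.sqrt n.factorial := by
        rw [mul_pow, ← Real.exp_nat_mul]; simp
      _ ≤ Real.exp (-k) * k.factorial * Real.sqrt n.factorial := by gcongr
      _ = _ := by ring
  refine (le_of_mul_le_mul_right h4 (by positivity)).trans ?_
  gcongr
  nlinarith

/-- There exists an integer `N` such that for all `n ≥ N`, every big irrep `V` of `S_n`
(i.e. with `dim V > e^{−√n·log n}·√(n!)`) and every permutation `π` whose cycle type
contains a part of size at least `8√n·log n` satisfy `χ_V(π) = 0`. -/
theorem char_eq_zero_of_big_cycle :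
    ∃ N : ℕ, ∀ n : ℕ, N ≤ n →
      ∀ V : FDRep ℂ (Equiv.Perm (Fin n)), Simple V →
        Real.exp (-(Real.sqrt n * Real.log n)) * Real.sqrt (n.factorial) <
          (Module.finrank ℂ V : ℝ) →
        ∀ π : Equiv.Perm (Fin n),
          (∃ k ∈ π.cycleType, 8 * Real.sqrt n * Real.log n ≤ (k : ℝ)) →
          V.character π = 0 := by
  refine ⟨9, fun n hn V hV hdim π ⟨k, hk, hkn⟩ => ?_⟩
  by_contra hπ
  rw [Equiv.Perm.cycleType_def, Multiset.mem_map] at hk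
  obtain ⟨c, hc, rfl⟩ := hk
  have h := Equiv.Perm.finrank_sq_mul_factorial_sq_le V.ρ V.eq_bot_or_eq_top_of_simple hc hπ
  rw [Fintype.card_fin] at h
  exact (le_exp_mul_sqrt_factorial hn hkn h).not_gt hdim
end
end

section
/- For all integers n and w with 1 ≤ w ≤ n, the number of permutations π ∈ S_n that possess an increasing subsequence of length w is at most (n choose w) · n!/w!. -/
noncomputable section

/-- For a fixed injection `f : α ↪ β` of a finite linear order into a finite linear order, at most
a fraction `1 / |α|!` of the permutations of `β` are increasing along `f`. -/
theorem factorial_mul_card_perms_strictMono_comp_le {α β : Type*} [Fintype α] [LinearOrder α]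
    [Fintype β] [LinearOrder β] (f : α ↪ β) :
    (Fintype.card α).factorial * Set.ncard {π : Equiv.Perm β | StrictMono (fun i => π (f i))} ≤
      (Fintype.card β).factorial := by
  rw [← Fintype.card_perm, ← Fintype.card_perm, ← Nat.card_eq_fintype_card,
    ← Nat.card_eq_fintype_card, ← Nat.card_coe_set_eq, ← Nat.card_prod]
  refine Nat.card_le_card_of_injective
    (fun p : Equiv.Perm α × {π : Equiv.Perm β | StrictMono (fun i => π (f i))} =>
      (p.2 : Equiv.Perm β) * p.1.viaEmbedding f) ?_
  rintro ⟨σ, π, hπ⟩ ⟨τ, ρ, hρ⟩ h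
  simp only at h
  have key (i : α) : π (f (σ i)) = ρ (f (τ i)) := by
    simpa [Equiv.Perm.viaEmbedding_apply] using DFunLike.congr_fun h (f i)
  have hrange : Set.range (fun i => π (f i)) = Set.range (fun i => ρ (f i)) := by
    rw [← σ.surjective.range_comp, ← τ.surjective.range_comp (fun i => ρ (f i))]
    exact congrArg Set.range (funext key)
  have heq : (fun i => π (f i)) = fun i => ρ (f i) := (StrictMono.range_inj hπ hρ).1 hrange
  have hστ : σ = τ := Equiv.ext fun i => hρ.injective ((congrFun heq (σ i)).symm.trans (key i))
  subst hστ
  simpa using h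

/-- For `1 ≤ w ≤ n`, the number of permutations `π ∈ S_n` that possess an increasing
subsequence of length `w` is at most `(n choose w) · n!/w!`. -/
theorem card_perms_with_increasing_subsequence_le (n w : ℕ) (hw : 1 ≤ w) (hn : w ≤ n) :
    (Set.ncard {π : Equiv.Perm (Fin n) |
        ∃ f : Fin w → Fin n, StrictMono f ∧ StrictMono (fun i => π (f i))} : ℝ) ≤
      (n.choose w : ℝ) * (n.factorial : ℝ) / (w.factorial : ℝ) := by
  rw [le_div_iff₀ (by positivity)]
  norm_cast
  let S := (Finset.univ : Finset (Fin n)).powersetCard w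
  let A (s : S) : Set (Equiv.Perm (Fin n)) :=
    {π | StrictMono (fun i => π (s.1.orderEmbOfFin (Finset.mem_powersetCard.1 s.2).2 i))}
  have hcover : {π : Equiv.Perm (Fin n) |
      ∃ f : Fin w → Fin n, StrictMono f ∧ StrictMono (fun i => π (f i))} ⊆ ⋃ s, A s := by
    rintro π ⟨f, hf, hπ⟩
    have hcard : (Finset.univ.image f).card = w := by
      simp [Finset.card_image_of_injective _ hf.injective]
    have hfs := Finset.orderEmbOfFin_unique hcard (f := f) (by simp) hf
    refine Set.mem_iUnion.2 ⟨⟨Finset.univ.image f, by simp [S, hcard]⟩, ?_⟩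
    change StrictMono (fun i => π ((Finset.univ.image f).orderEmbOfFin hcard i))
    rwa [← hfs]
  calc
    _ ≤ (∑ s, (A s).ncard) * w.factorial := by
      gcongr
      exact (Set.ncard_le_ncard hcover (Set.toFinite _)).trans
        (Set.ncard_iUnion_le_of_fintype A)
    _ ≤ ∑ _s : S, n.factorial := by
      rw [Finset.sum_mul]
      refine Finset.sum_le_sum fun s _ => ?_
      rw [mul_comm]
      simpa using factorial_mul_card_perms_strictMono_comp_le
        (s.1.orderEmbOfFin (Finset.mem_powersetCard.1 s.2).2).toEmbedding
    _ = n.choose w * n.factorial := by simp [S]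
end
end

section
/- Let G be a finite group and ℓ ≥ 1 an integer. For a subset I ⊆ {1, …, ℓ} and a ∈ G, let R_I(a) be the linear operator on the complex vector space with basis {e_g : g ∈ G^ℓ} defined by R_I(a)·e_g = e_{g'}, where g'_j = g_j·a for j ∈ I and g'_j = g_j for j ∉ I. For a class function χ : G → ℂ, define Π_I^χ = (1/|G|) ∑_{a∈G} χ(a)* · R_I(a). Then for any class functions χ, χ' on G and any subsets I, J ⊆ {1, …, ℓ} such that I ⊆ J, J ⊆ I, or I ∩ J = ∅, the operators Π_I^χ and Π_J^{χ'} commute: Π_I^χ ∘ Π_J^{χ'} = Π_J^{χ'} ∘ Π_I^χ. -/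
noncomputable section

/-- The operator `R_I(a)` on the space of complex functions on `G^ℓ` (formal linear
combinations of basis vectors `e_g`, `g ∈ G^ℓ`), defined by `R_I(a)·e_g = e_{g'}` where
`g'_j = g_j·a` for `j ∈ I` and `g'_j = g_j` otherwise. -/
def Rop (G : Type) [Group G] {ℓ : ℕ} (I : Finset (Fin ℓ)) (a : G) :
    ((Fin ℓ → G) → ℂ) →ₗ[ℂ] ((Fin ℓ → G) → ℂ) :=
  LinearMap.funLeft ℂ ℂ (fun x j => if j ∈ I then x j * a⁻¹ else x j)

/-- The operator `Π_I^χ = (1/|G|) ∑_{a∈G} χ(a)* · R_I(a)`. -/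
def Piop (G : Type) [Group G] [Fintype G] {ℓ : ℕ} (χ : G → ℂ) (I : Finset (Fin ℓ)) :
    ((Fin ℓ → G) → ℂ) →ₗ[ℂ] ((Fin ℓ → G) → ℂ) :=
  (Fintype.card G : ℂ)⁻¹ • ∑ a : G, starRingEnd ℂ (χ a) • Rop G I a

theorem Rop_comp_Rop_of_subset (G : Type) [Group G] {ℓ : ℕ} {I J : Finset (Fin ℓ)}
    (h : I ⊆ J) (a b : G) :
    Rop G I a ∘ₗ Rop G J b = Rop G J b ∘ₗ Rop G I (b * a * b⁻¹) := by
  ext1 f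
  funext x
  simp only [Rop, LinearMap.comp_apply, LinearMap.funLeft_apply]
  congr 1
  funext j
  by_cases hI : j ∈ I
  · simp [hI, h hI, mul_assoc]
  · simp [hI]

theorem Rop_comp_Rop_of_disjoint (G : Type) [Group G] {ℓ : ℕ} {I J : Finset (Fin ℓ)}
    (h : Disjoint I J) (a b : G) :
    Rop G I a ∘ₗ Rop G J b = Rop G J b ∘ₗ Rop G I a := by
  ext1 f
  funext x
  simp only [Rop, LinearMap.comp_apply, LinearMap.funLeft_apply]
  congr 1
  funext j
  by_cases hI : j ∈ I
  · simp [hI, Finset.disjoint_left.mp h hI]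
  · simp [hI]

/-- If `T` commutes with every `R_J(b)`, then it commutes with `Π_J^χ`. -/
theorem comp_Piop_of_comp_Rop (G : Type) [Group G] [Fintype G] {ℓ : ℕ} (χ : G → ℂ)
    (J : Finset (Fin ℓ)) (T : ((Fin ℓ → G) → ℂ) →ₗ[ℂ] ((Fin ℓ → G) → ℂ))
    (h : ∀ b, T ∘ₗ Rop G J b = Rop G J b ∘ₗ T) :
    T ∘ₗ Piop G χ J = Piop G χ J ∘ₗ T := by
  simp only [← Module.End.mul_eq_comp] at h ⊢
  simp only [Piop, mul_smul_comm, smul_mul_assoc, Finset.mul_sum, Finset.sum_mul, h]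

/-- For a class function `χ` and `I ⊆ J`, the operator `Π_I^χ` commutes with every `R_J(b)`. -/
theorem Piop_comp_Rop_of_subset (G : Type) [Group G] [Fintype G] {ℓ : ℕ} {χ : G → ℂ}
    (hχ : ∀ a b : G, χ (b⁻¹ * a * b) = χ a) {I J : Finset (Fin ℓ)} (h : I ⊆ J) (b : G) :
    Piop G χ I ∘ₗ Rop G J b = Rop G J b ∘ₗ Piop G χ I := by
  have hR := fun a => Rop_comp_Rop_of_subset G h a b
  simp only [← Module.End.mul_eq_comp] at hR ⊢
  simp only [Piop, mul_smul_comm, smul_mul_assoc, Finset.mul_sum, Finset.sum_mul, hR]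
  congr 1
  refine Fintype.sum_equiv (MulAut.conj b).toEquiv _ _ fun a => ?_
  have hc : χ (b * a * b⁻¹) = χ a := by simpa using hχ a b⁻¹
  simp [hc]

theorem Piop_comm_of_subset (G : Type) [Group G] [Fintype G] {ℓ : ℕ} {χ : G → ℂ} (χ' : G → ℂ)
    (hχ : ∀ a b : G, χ (b⁻¹ * a * b) = χ a) {I J : Finset (Fin ℓ)} (h : I ⊆ J) :
    Piop G χ I ∘ₗ Piop G χ' J = Piop G χ' J ∘ₗ Piop G χ I :=
  comp_Piop_of_comp_Rop G χ' J _ (Piop_comp_Rop_of_subset G hχ h)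

/-- For class functions `χ, χ'` on a finite group `G` and subsets `I, J ⊆ {1,…,ℓ}` with
`I ⊆ J`, `J ⊆ I`, or `I ∩ J = ∅`, the operators `Π_I^χ` and `Π_J^{χ'}` commute. -/
theorem Piop_comm (G : Type) [Group G] [Fintype G] (ℓ : ℕ) (hℓ : 1 ≤ ℓ)
    (χ χ' : G → ℂ)
    (hχ : ∀ a b : G, χ (b⁻¹ * a * b) = χ a)
    (hχ' : ∀ a b : G, χ' (b⁻¹ * a * b) = χ' a)
    (I J : Finset (Fin ℓ)) (hIJ : I ⊆ J ∨ J ⊆ I ∨ Disjoint I J) :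
    Piop G χ I ∘ₗ Piop G χ' J = Piop G χ' J ∘ₗ Piop G χ I := by
  rcases hIJ with h | h | h
  · exact Piop_comm_of_subset G χ' hχ h
  · exact (Piop_comm_of_subset G χ hχ' h).symm
  · exact comp_Piop_of_comp_Rop G χ' J _ fun b =>
      (comp_Piop_of_comp_Rop G χ I _ fun a => (Rop_comp_Rop_of_disjoint G h a b).symm).symm
end
end
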